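/- Let p be a prime, q = p^{n₀} a power of p, and ρ a permutation of ℕ. If i = i_0 + i_1 + ⋯ + i_e is an admissible representation of the nonnegative integer i relative to e, then ρ_*(i) = ρ_*(i_0) + ρ_*(i_1) + ⋯ + ρ_*(i_e), and this is an admissible representation of ρ_*(i) relative to e. -/

import Mathlib

/-- The digit permutation map on natural numbers: if `n = Σ_i c_i q^i` `q`-adically, then
`rhoStar q ρ n = Σ_i c_i q^{ρ(i)}`. -/
def rhoStar (q : ℕ) (ρ : Equiv.Perm ℕ) (n : ℕ) : ℕ :=
  ∑ i ∈ Finset.range (n + 1), (n / q ^ i % q) * q ^ (ρ i)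

/-- Digit extraction from a sparse expansion in base `b`. -/
theorem sum_mul_pow_div_pow_mod {b : ℕ} (hb : 0 < b) {g : ℕ → ℕ} (hg : ∀ k, g k < b)
    (s : Finset ℕ) (t : ℕ) :
    (∑ k ∈ s, g k * b ^ k) / b ^ t % b = if t ∈ s then g t else 0 := by
  have sum_lt : ∀ (s : Finset ℕ) (a : ℕ), (∀ x ∈ s, x < a) → ∑ k ∈ s, g k * b ^ k < b ^ a := by
    intro s a
    induction s using Finset.induction_on_max generalizing a with
    | empty => simpa using Nat.pow_pos (n := a) hb
    | insert m s hm ih =>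
      intro h
      rw [Finset.sum_insert fun hms => (hm m hms).false]
      have hma : m < a := h m (Finset.mem_insert_self m s)
      calc g m * b ^ m + ∑ k ∈ s, g k * b ^ k < g m * b ^ m + b ^ m := by gcongr; exact ih m hm
        _ = (g m + 1) * b ^ m := by ring
        _ ≤ b * b ^ m := Nat.mul_le_mul_right _ (hg m)
        _ = b ^ (m + 1) := by ring
        _ ≤ b ^ a := Nat.pow_le_pow_right hb hma
  induction s using Finset.induction_on_max with
  | empty => simp
  | insert m s hm ih =>
    have hms : m ∉ s := fun hms => (hm m hms).false
    rcases lt_trichotomy t m with htm | rfl | hmt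
    · obtain ⟨d, rfl⟩ := Nat.exists_eq_add_of_lt htm
      rw [Finset.sum_insert hms, add_comm,
        show g (t + d + 1) * b ^ (t + d + 1) = b ^ t * (b * (g (t + d + 1) * b ^ d)) by ring,
        Nat.add_mul_div_left _ _ (Nat.pow_pos hb), Nat.add_mul_mod_self_left, ih]
      simp [Finset.mem_insert, htm.ne]
    · rw [Finset.sum_insert hms, add_comm, Nat.add_mul_div_right _ _ (Nat.pow_pos hb),
        Nat.div_eq_of_lt (sum_lt s t hm), zero_add, Nat.mod_eq_of_lt (hg t)]
      simp
    · have hlt : ∀ x ∈ insert m s, x < t := by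
        intro x hx
        rcases Finset.mem_insert.1 hx with rfl | hx
        · exact hmt
        · exact (hm x hx).trans hmt
      rw [Nat.div_eq_of_lt (sum_lt _ t hlt), Nat.zero_mod,
        if_neg fun ht => (hlt t ht).false]

theorem sum_range_div_pow_mod_mul_pow (b n N : ℕ) :
    ∑ k ∈ Finset.range N, (n / b ^ k % b) * b ^ k = n % b ^ N := by
  induction N with
  | zero => simp [Nat.mod_one]
  | succ N ih => rw [Finset.sum_range_succ, ih, Nat.mod_pow_succ, mul_comm (b ^ N)]

theorem sum_div_pow_of_no_carry {α : Type*} (s : Finset α) {b : ℕ} (hb : 0 < b) (x : α → ℕ)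
    (h : ∀ t, ∑ j ∈ s, (x j / b ^ t % b) < b) (t : ℕ) :
    (∑ j ∈ s, x j) / b ^ t = ∑ j ∈ s, x j / b ^ t := by
  induction t with
  | zero => simp
  | succ t ih =>
    have hsplit : ∑ j ∈ s, x j / b ^ t
        = ∑ j ∈ s, (x j / b ^ t % b) + b * ∑ j ∈ s, x j / b ^ t / b := by
      rw [Finset.mul_sum, ← Finset.sum_add_distrib]
      exact Finset.sum_congr rfl fun j _ => (Nat.mod_add_div _ _).symm
    rw [pow_succ, ← Nat.div_div_eq_div_mul, ih, hsplit, Nat.add_mul_div_left _ _ hb,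
      Nat.div_eq_of_lt (h t), zero_add]
    exact Finset.sum_congr rfl fun j _ => Nat.div_div_eq_div_mul _ _ _

theorem sum_mod_pow_of_no_carry {α : Type*} (s : Finset α) {b : ℕ} (hb : 0 < b) (x : α → ℕ)
    (h : ∀ t, ∑ j ∈ s, (x j / b ^ t % b) < b) (t : ℕ) :
    (∑ j ∈ s, x j) % b ^ t = ∑ j ∈ s, x j % b ^ t := by
  have hsplit : ∑ j ∈ s, x j = ∑ j ∈ s, x j % b ^ t + b ^ t * ∑ j ∈ s, x j / b ^ t := by
    rw [Finset.mul_sum, ← Finset.sum_add_distrib]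
    exact Finset.sum_congr rfl fun j _ => (Nat.mod_add_div _ _).symm
  have hdiv := Nat.mod_add_div (∑ j ∈ s, x j) (b ^ t)
  rw [sum_div_pow_of_no_carry s hb x h t] at hdiv
  omega

/-- Without carries in base `b`, the digits in base `b ^ m` add up. -/
theorem sum_div_pow_mod_pow_of_no_carry {α : Type*} (s : Finset α) {b : ℕ} (hb : 0 < b)
    (x : α → ℕ) (h : ∀ t, ∑ j ∈ s, (x j / b ^ t % b) < b) (m t : ℕ) :
    (∑ j ∈ s, x j) / (b ^ m) ^ t % b ^ m = ∑ j ∈ s, (x j / (b ^ m) ^ t % b ^ m) := by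
  rw [← pow_mul, sum_div_pow_of_no_carry s hb x h]
  refine sum_mod_pow_of_no_carry s hb _ (fun u => ?_) m
  simpa only [Nat.div_div_eq_div_mul, ← pow_add] using h (m * t + u)

/-- The digit of `n` at position `m * a + c` in base `b`, read off from base `b ^ m`. -/
theorem div_pow_mul_add_mod (b n a : ℕ) {m c : ℕ} (hc : c < m) :
    n / b ^ (m * a + c) % b = n / (b ^ m) ^ a % b ^ m / b ^ c % b := by
  obtain ⟨d, rfl⟩ := Nat.exists_eq_add_of_lt hc
  rw [pow_add, ← Nat.div_div_eq_div_mul, pow_mul, add_assoc, pow_add b c,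
    Nat.mod_mul_right_div_self, pow_succ', Nat.mod_mul_right_mod]

theorem div_pow_eq_zero_of_le {q n k : ℕ} (hq : 1 < q) (h : n ≤ k) : n / q ^ k = 0 :=
  Nat.div_eq_of_lt (h.trans_lt (Nat.lt_pow_self hq))

theorem rhoStar_eq_sum_range {q : ℕ} (hq : 1 < q) (ρ : Equiv.Perm ℕ) {n N : ℕ} (h : n < N) :
    rhoStar q ρ n = ∑ k ∈ Finset.range N, (n / q ^ k % q) * q ^ (ρ k) := by
  refine Finset.sum_subset (Finset.range_mono h) fun k _ hk => ?_
  have hk' : n ≤ k := by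
    simp only [Finset.mem_range] at hk
    omega
  simp [div_pow_eq_zero_of_le hq hk']

theorem rhoStar_one {q : ℕ} (hq : 1 < q) (n : ℕ) : rhoStar q 1 n = n := by
  simp only [rhoStar, Equiv.Perm.coe_one, id_eq]
  rw [sum_range_div_pow_mod_mul_pow]
  exact Nat.mod_eq_of_lt ((Nat.lt_succ_self n).trans (Nat.lt_pow_self hq))

theorem rhoStar_div_pow_mod {q : ℕ} (hq : 1 < q) (ρ : Equiv.Perm ℕ) (n a : ℕ) :
    rhoStar q ρ n / q ^ a % q = n / q ^ (ρ.symm a) % q := by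
  have hq0 : 0 < q := by omega
  have hmap : rhoStar q ρ n = ∑ k ∈ (Finset.range (n + 1)).map ρ.toEmbedding,
      (n / q ^ (ρ.symm k) % q) * q ^ k := by
    simp [rhoStar, Finset.sum_map]
  rw [hmap, sum_mul_pow_div_pow_mod hq0 fun k => Nat.mod_lt (n / q ^ (ρ.symm k)) hq0]
  split_ifs with h
  · rfl
  · have hle : n ≤ ρ.symm a := by
      by_contra! hlt
      exact h (Finset.mem_map.2 ⟨ρ.symm a, Finset.mem_range.2 (by omega), by simp⟩)
    rw [div_pow_eq_zero_of_le hq hle, Nat.zero_mod]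

theorem rhoStar_pos {q : ℕ} (hq : 1 < q) (ρ : Equiv.Perm ℕ) {n : ℕ} (hn : 0 < n) :
    0 < rhoStar q ρ n := by
  by_contra! h0
  have hdigit : ∀ k, n / q ^ k % q = 0 := fun k => by
    simpa [Nat.le_zero.1 h0] using (rhoStar_div_pow_mod hq ρ n (ρ k)).symm
  have hn0 := rhoStar_one hq n
  simp only [rhoStar, hdigit, zero_mul, Finset.sum_const_zero] at hn0
  omega

theorem rhoStar_modEq_sum_digits {q : ℕ} (hq : 1 < q) (ρ : Equiv.Perm ℕ) (n : ℕ) :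
    rhoStar q ρ n ≡ ∑ k ∈ Finset.range (n + 1), n / q ^ k % q [MOD q - 1] := by
  have hq1 : q ≡ 1 [MOD q - 1] := ((Nat.modEq_iff_dvd' hq.le).2 dvd_rfl).symm
  refine Nat.ModEq.sum fun k _ => ?_
  simpa using (hq1.pow (ρ k)).mul_left (n / q ^ k % q)

theorem rhoStar_modEq {q : ℕ} (hq : 1 < q) (ρ : Equiv.Perm ℕ) (n : ℕ) :
    rhoStar q ρ n ≡ n [MOD q - 1] := by
  have h := (rhoStar_modEq_sum_digits hq ρ n).trans (rhoStar_modEq_sum_digits hq 1 n).symm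
  rwa [rhoStar_one hq] at h

/-- if `i = i_0 + ⋯ + i_e` is an admissible representation of `i` relative
to `e` (no carryover of `p`-adic digits, and for `j < e` the part `i_j` is positive and
divisible by `q − 1`), then `ρ_*(i) = ρ_*(i_0) + ⋯ + ρ_*(i_e)` is an admissible
representation of `ρ_*(i)` relative to `e`. -/
theorem rhoStar_admissible_representation (p n₀ : ℕ) (hp : p.Prime) (hn₀ : 0 < n₀)
    (q : ℕ) (hq : q = p ^ n₀) (ρ : Equiv.Perm ℕ)
    (e : ℕ) (ι : ℕ → ℕ) (i : ℕ)
    (hsum : i = ∑ j ∈ Finset.range (e + 1), ι j)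
    (hnocarry : ∀ t : ℕ, ∑ j ∈ Finset.range (e + 1), (ι j / p ^ t % p) < p)
    (hparts : ∀ j < e, 0 < ι j ∧ (q - 1) ∣ ι j) :
    rhoStar q ρ i = ∑ j ∈ Finset.range (e + 1), rhoStar q ρ (ι j) ∧
    (∀ t : ℕ, ∑ j ∈ Finset.range (e + 1), (rhoStar q ρ (ι j) / p ^ t % p) < p) ∧
    (∀ j < e, 0 < rhoStar q ρ (ι j) ∧ (q - 1) ∣ rhoStar q ρ (ι j)) := by
  have hq1 : 1 < q := hq ▸ Nat.one_lt_pow hn₀.ne' hp.one_lt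
  refine ⟨?_, fun t => ?_, fun j hj => ⟨rhoStar_pos hq1 ρ (hparts j hj).1, ?_⟩⟩
  · have hdigit : ∀ k, i / q ^ k % q = ∑ j ∈ Finset.range (e + 1), (ι j / q ^ k % q) := by
      intro k
      rw [hsum, hq]
      exact sum_div_pow_mod_pow_of_no_carry _ hp.pos ι hnocarry n₀ k
    have hle : ∀ j ∈ Finset.range (e + 1), ι j < i + 1 := fun j hj => by
      rw [hsum]
      exact Nat.lt_succ_of_le (Finset.single_le_sum (fun _ _ => Nat.zero_le _) hj)
    rw [Finset.sum_congr rfl fun j hj => rhoStar_eq_sum_range hq1 ρ (hle j hj), Finset.sum_comm]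
    simp only [rhoStar, hdigit, Finset.sum_mul]
  · have hc : t % n₀ < n₀ := Nat.mod_lt t hn₀
    have hdigit : ∀ n, rhoStar q ρ n / p ^ t % p
        = n / p ^ (n₀ * ρ.symm (t / n₀) + t % n₀) % p := by
      intro n
      have h := div_pow_mul_add_mod p (rhoStar q ρ n) (t / n₀) hc
      rw [Nat.div_add_mod, ← hq, rhoStar_div_pow_mod hq1] at h
      rw [h, div_pow_mul_add_mod p n _ hc, hq]
    simpa only [hdigit] using hnocarry (n₀ * ρ.symm (t / n₀) + t % n₀)
  · exact ((rhoStar_modEq hq1 ρ (ι j)).dvd_iff dvd_rfl).2 (hparts j hj).2
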